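/- For any degree sequence {k_i} realizable by a loopy graph, the graph of loopy graphs 𝒢({k_i}) is disconnected if and only if there exists a loopy graph with degree sequence {k_i} belonging to class Q1 or to class Q2. -/

import Mathlib

open scoped Classical

/-- A loopy graph: at most one edge between any two distinct vertices and at most one
self-loop at each vertex, encoded as a symmetric adjacency relation. -/
structure LoopyGraph (V : Type) where
  Adj : V → V → Prop
  symm : ∀ u v : V, Adj u v → Adj v u

namespace LoopyGraph

variable {V : Type}

/-- The neighbors of `u` (vertices other than `u` adjacent to `u`). -/
def nbr (G : LoopyGraph V) (u : V) : Set V := {v | v ≠ u ∧ G.Adj u v}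

/-- Degree of a vertex: each self-loop contributes `2`. -/
noncomputable def deg (G : LoopyGraph V) (u : V) : ℕ :=
  (G.nbr u).ncard + (if G.Adj u u then 2 else 0)

/-- `G₂` is obtained from `G₁` by a single valid double edge swap
`(u,v),(x,y) ⤳ (u,x),(v,y)`: the two removed edges are distinct edges of `G₁`, the two
added edges are distinct and not already present (no multiedge and no doubled
self-loop is created). -/
def DoubleEdgeSwap (G₁ G₂ : LoopyGraph V) : Prop :=
  ∃ u v x y : V,
    G₁.Adj u v ∧ G₁.Adj x y ∧
    s(u, v) ≠ s(x, y) ∧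
    ¬ G₁.Adj u x ∧ ¬ G₁.Adj v y ∧ s(u, x) ≠ s(v, y) ∧
    ∀ a b : V, G₂.Adj a b ↔
      ((G₁.Adj a b ∧ s(a, b) ≠ s(u, v) ∧ s(a, b) ≠ s(x, y)) ∨
        s(a, b) = s(u, x) ∨ s(a, b) = s(v, y))

/-- `G₂` is reachable from `G₁` by a finite sequence of valid double edge swaps. -/
def Reach (G₁ G₂ : LoopyGraph V) : Prop :=
  Relation.ReflTransGen DoubleEdgeSwap G₁ G₂

/-- Vertices at (shortest-path) distance at most `k` from the set of loop-free vertices. -/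
def within (G : LoopyGraph V) : ℕ → Set V
  | 0 => {v | ¬ G.Adj v v}
  | (k + 1) => within G k ∪ {v | ∃ u ∈ within G k, G.Adj v u}

/-- `Vset G 0 = V^0` is the set of vertices with no self-loop; for `k ≥ 1`,
`Vset G k = V^k` is the set of vertices (necessarily carrying a self-loop) whose
shortest-path distance to `V^0` is exactly `k`. -/
def Vset (G : LoopyGraph V) : ℕ → Set V
  | 0 => {v | ¬ G.Adj v v}
  | (k + 1) => within G (k + 1) \ within G k

/-- `V^∞`: vertices (with a self-loop) having no path to `V^0`. -/
def Vinf (G : LoopyGraph V) : Set V := {v | ∀ k : ℕ, v ∉ within G k}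

/-- A set of vertices is a clique when all pairs of distinct members are adjacent. -/
def IsClique (G : LoopyGraph V) (s : Set V) : Prop :=
  ∀ x ∈ s, ∀ y ∈ s, x ≠ y → G.Adj x y

/-- The set of vertices carrying a self-loop. -/
def selfLoops (G : LoopyGraph V) : Set V := {v | G.Adj v v}

/-- The edges of `G` with both endpoints in `V^0`. -/
def V0edges (G : LoopyGraph V) : Set (Sym2 V) :=
  {e | ∃ u v : V, e = s(u, v) ∧ G.Adj u v ∧ u ∈ Vset G 0 ∧ v ∈ Vset G 0}

/-- `Ĝ` is swap-maximal: among all loopy graphs reachable from it by double edge swaps it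
has the maximum number of self-loops, and subject to that the maximum number of edges with
both endpoints in `V^0`. -/
def SwapMaximal (G : LoopyGraph V) : Prop :=
  ∀ H : LoopyGraph V, Reach G H →
    (selfLoops H).ncard ≤ (selfLoops G).ncard ∧
      ((selfLoops H).ncard = (selfLoops G).ncard →
        (V0edges H).ncard ≤ (V0edges G).ncard)

/-- `K` is a largest clique contained in `V^0`, and it has exactly `d` vertices. -/
def LargestV0Clique (G : LoopyGraph V) (K : Set V) (d : ℕ) : Prop :=
  K ⊆ Vset G 0 ∧ IsClique G K ∧ K.ncard = d ∧
    ∀ K' : Set V, K' ⊆ Vset G 0 → IsClique G K' → K'.ncard ≤ d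

/-- Class `Q1`. -/
def Q1 (G : LoopyGraph V) : Prop :=
  ∃ K : Set V, K ⊆ Vset G 0 ∧ 4 ≤ K.ncard ∧ IsClique G K ∧
    (∀ u ∈ Vset G 0, (∀ w ∈ Vset G 0, ¬ G.Adj u w) ∨ u ∈ K) ∧
    IsClique G (Vset G 1 ∪ K) ∧
    Vset G 2 = ∅ ∧ Vinf G = ∅

/-- Class `Q2`. -/
def Q2 (G : LoopyGraph V) : Prop :=
  3 ≤ {u | u ∈ Vset G 0 ∧ (nbr G u ∩ Vset G 0).ncard = 2}.ncard ∧
  (∀ u ∈ Vset G 0,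
      (∀ w ∈ Vset G 0, ¬ G.Adj u w) ∨
        ((nbr G u ∩ Vset G 0).ncard = 2 ∧ ∀ w ∈ Vset G 1, G.Adj u w)) ∧
  IsClique G (Vset G 1) ∧
  (∀ u ∈ Vset G 2, nbr G u = Vset G 1) ∧
  Vset G 3 = ∅ ∧
  (Vinf G = ∅ ∨ (Vset G 1 = ∅ ∧ ∀ u ∈ Vinf G, deg G u = 2))

/-- The graph of loopy graphs `𝒢({k_i})` is connected: any two loopy graphs with degree
sequence `k` are linked by a finite sequence of valid double edge swaps. -/
def GConnected (k : V → ℕ) : Prop :=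
  ∀ G₁ G₂ : LoopyGraph V, (∀ v, deg G₁ v = k v) → (∀ v, deg G₂ v = k v) →
    Reach G₁ G₂

/-- `G₂` is obtained from `G₁` by a single valid triangle-loop swap: either a triangle on
three distinct vertices is replaced by three self-loops, or conversely. -/
def TriangleLoopSwap (G₁ G₂ : LoopyGraph V) : Prop :=
  ∃ u v w : V, u ≠ v ∧ v ≠ w ∧ u ≠ w ∧
    ((G₁.Adj u v ∧ G₁.Adj v w ∧ G₁.Adj w u ∧
        ¬ G₁.Adj u u ∧ ¬ G₁.Adj v v ∧ ¬ G₁.Adj w w ∧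
        ∀ a b : V, G₂.Adj a b ↔
          ((G₁.Adj a b ∧ s(a, b) ≠ s(u, v) ∧ s(a, b) ≠ s(v, w) ∧ s(a, b) ≠ s(w, u)) ∨
            s(a, b) = s(u, u) ∨ s(a, b) = s(v, v) ∨ s(a, b) = s(w, w))) ∨
      (G₁.Adj u u ∧ G₁.Adj v v ∧ G₁.Adj w w ∧
        ¬ G₁.Adj u v ∧ ¬ G₁.Adj v w ∧ ¬ G₁.Adj w u ∧
        ∀ a b : V, G₂.Adj a b ↔
          ((G₁.Adj a b ∧ s(a, b) ≠ s(u, u) ∧ s(a, b) ≠ s(v, v) ∧ s(a, b) ≠ s(w, w)) ∨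
            s(a, b) = s(u, v) ∨ s(a, b) = s(v, w) ∨ s(a, b) = s(w, u))))

/-- Reachability in the augmented graph of loopy graphs `𝒢_△`: a finite sequence of moves,
each a valid double edge swap or a valid triangle-loop swap. -/
def ReachTri (G₁ G₂ : LoopyGraph V) : Prop :=
  Relation.ReflTransGen
    (fun H₁ H₂ => DoubleEdgeSwap H₁ H₂ ∨ TriangleLoopSwap H₁ H₂) G₁ G₂

/-- `S` is a set of highest-degree vertices for the degree sequence `k`. -/
def TopSet (k : V → ℕ) (S : Set V) : Prop :=
  ∀ u ∈ S, ∀ v : V, v ∉ S → k v ≤ k u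

/-- A loopy graph is simple when it has no self-loops. -/
def IsSimple (G : LoopyGraph V) : Prop := ∀ v : V, ¬ G.Adj v v

/-- `k` is the degree sequence of some simple graph. -/
def SimpleGraphical (k : V → ℕ) : Prop :=
  ∃ G : LoopyGraph V, IsSimple G ∧ ∀ v, deg G v = k v

/-- `k` is `m`-simple-graphical: subtracting `2` from each of the `m` largest entries
yields a simple-graphical sequence. -/
def MSimpleGraphical (k : V → ℕ) (m : ℕ) : Prop :=
  ∃ S : Set V, S.ncard = m ∧ TopSet k S ∧ (∀ v ∈ S, 2 ≤ k v) ∧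
    SimpleGraphical (fun v : V => if v ∈ S then k v - 2 else k v)

/-- `m` is `m*`, the maximum `m` for which the sequence is `m`-simple-graphical. -/
def IsMStar (k : V → ℕ) (m : ℕ) : Prop :=
  MSimpleGraphical k m ∧ ∀ m' : ℕ, MSimpleGraphical k m' → m' ≤ m

/-- `G` is `m`-loopy: it has self-loops exactly at `m` highest-degree vertices. -/
def MLoopy (G : LoopyGraph V) (m : ℕ) : Prop :=
  (selfLoops G).ncard = m ∧ TopSet (deg G) (selfLoops G)

end LoopyGraph

namespace LoopyGraph

variable {V : Type}

/-- The indicator function of the edge set. -/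
noncomputable def ind (G : LoopyGraph V) (e : Sym2 V) : ℤ :=
  if e ∈ Sym2.fromRel (r := G.Adj) ⟨G.symm⟩ then 1 else 0

/-- The indicator function of a single edge. -/
noncomputable def single (a b : V) (e : Sym2 V) : ℤ := if e = s(a, b) then 1 else 0

theorem ind_mk (G : LoopyGraph V) (a b : V) : G.ind s(a, b) = if G.Adj a b then 1 else 0 := by
  simp [ind]

theorem ind_eq_one {G : LoopyGraph V} {a b : V} : G.ind s(a, b) = 1 ↔ G.Adj a b := by
  simp [ind_mk]

theorem ind_eq_zero {G : LoopyGraph V} {a b : V} : G.ind s(a, b) = 0 ↔ ¬ G.Adj a b := by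
  simp [ind_mk]

theorem ind_injective : Function.Injective (ind : LoopyGraph V → Sym2 V → ℤ) := by
  intro G H h
  have : G.Adj = H.Adj := by
    ext a b
    rw [← ind_eq_one, ← ind_eq_one, h]
  cases G; cases H; simpa using this

theorem single_comm (a b : V) : single a b = single b a := by
  ext e; simp [single, Sym2.eq_swap]

theorem adj_comm (G : LoopyGraph V) {a b : V} : G.Adj a b ↔ G.Adj b a :=
  ⟨G.symm _ _, G.symm _ _⟩

theorem ind_of_swap {G H : LoopyGraph V} {u v x y : V} (huv : G.Adj u v) (hxy : G.Adj x y)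
    (hne : s(u, v) ≠ s(x, y)) (hux : ¬ G.Adj u x) (hvy : ¬ G.Adj v y)
    (hne' : s(u, x) ≠ s(v, y))
    (hH : ∀ a b : V, H.Adj a b ↔ ((G.Adj a b ∧ s(a, b) ≠ s(u, v) ∧ s(a, b) ≠ s(x, y)) ∨
        s(a, b) = s(u, x) ∨ s(a, b) = s(v, y))) :
    H.ind = G.ind - single u v - single x y + single u x + single v y := by
  rw [← ind_eq_one] at huv hxy
  rw [← ind_eq_zero] at hux hvy
  ext e
  induction e with | _ a b
  have hH : H.ind s(a, b) = if (G.ind s(a, b) = 1 ∧ s(a, b) ≠ s(u, v) ∧ s(a, b) ≠ s(x, y)) ∨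
        s(a, b) = s(u, x) ∨ s(a, b) = s(v, y) then 1 else 0 := by
    simp only [ind_mk H, ind_eq_one, hH]
  have h01 : G.ind s(a, b) = 0 ∨ G.ind s(a, b) = 1 := by
    rw [ind_mk]; split_ifs <;> simp
  simp only [Pi.add_apply, Pi.sub_apply, hH, single]
  generalize s(a, b) = e at *
  grind

theorem exists_swap (G : LoopyGraph V) (u v x y : V) (huv : G.Adj u v) (hxy : G.Adj x y)
    (hne : s(u, v) ≠ s(x, y)) (hux : ¬ G.Adj u x) (hvy : ¬ G.Adj v y)
    (hne' : s(u, x) ≠ s(v, y)) :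
    ∃ H : LoopyGraph V, Reach G H ∧
      H.ind = G.ind - single u v - single x y + single u x + single v y := by
  let H : LoopyGraph V :=
    { Adj := fun a b => (G.Adj a b ∧ s(a, b) ≠ s(u, v) ∧ s(a, b) ≠ s(x, y)) ∨
        s(a, b) = s(u, x) ∨ s(a, b) = s(v, y)
      symm := fun a b h => by rwa [Sym2.eq_swap (a := b), adj_comm] }
  exact ⟨H, .single ⟨u, v, x, y, huv, hxy, hne, hux, hvy, hne', fun a b => Iff.rfl⟩,
    ind_of_swap huv hxy hne hux hvy hne' fun a b => Iff.rfl⟩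

theorem exists_loop (G : LoopyGraph V) (a p q : V) (hp : G.ind s(a, p) = 1)
    (hq : G.ind s(a, q) = 1) (hpq : p ≠ q) (ha : G.ind s(a, a) = 0) (h : G.ind s(p, q) = 0) :
    ∃ H : LoopyGraph V, Reach G H ∧
      H.ind = G.ind - single a p - single a q + single a a + single p q :=
  G.exists_swap a p a q (ind_eq_one.1 hp) (ind_eq_one.1 hq) (by rw [Ne, Sym2.eq_iff]; grind)
    (ind_eq_zero.1 ha) (ind_eq_zero.1 h) (by rw [Ne, Sym2.eq_iff]; grind)

theorem exists_unloop (G : LoopyGraph V) (a p q : V) (ha : G.ind s(a, a) = 1)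
    (h : G.ind s(p, q) = 1) (hpq : p ≠ q) (hp : G.ind s(a, p) = 0) (hq : G.ind s(a, q) = 0) :
    ∃ H : LoopyGraph V, Reach G H ∧
      H.ind = G.ind - single a a - single p q + single a p + single a q :=
  G.exists_swap a a p q (ind_eq_one.1 ha) (ind_eq_one.1 h) (by rw [Ne, Sym2.eq_iff]; grind)
    (ind_eq_zero.1 hp) (ind_eq_zero.1 hq) (by rw [Ne, Sym2.eq_iff]; grind)

/-- The vertices `u`, `v`, `w` form a triangle without self-loops. -/
structure IsTriangle (G : LoopyGraph V) (u v w : V) : Prop where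
  uv : G.Adj u v
  vw : G.Adj v w
  wu : G.Adj w u
  uu : ¬ G.Adj u u
  vv : ¬ G.Adj v v
  ww : ¬ G.Adj w w

theorem IsTriangle.reversed_and_ne {G : LoopyGraph V} {u v w : V} (h : G.IsTriangle u v w) :
    (G.Adj v u ∧ G.Adj w v ∧ G.Adj u w) ∧ u ≠ v ∧ v ≠ w ∧ w ≠ u ∧ v ≠ u ∧ w ≠ v ∧ u ≠ w := by
  refine ⟨⟨G.symm _ _ h.uv, G.symm _ _ h.vw, G.symm _ _ h.wu⟩, ?_⟩
  grind [h.uv, h.vw, h.wu, h.uu, h.vv, h.ww]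

/-- `H` arises from `G` by replacing the triangle `u`, `v`, `w` with three self-loops. -/
structure IsFlip (G H : LoopyGraph V) (u v w : V) : Prop extends G.IsTriangle u v w where
  ind_eq : H.ind = G.ind - single u v - single v w - single w u +
    single u u + single v v + single w w

theorem IsFlip.rotate {G H : LoopyGraph V} {u v w : V} (h : IsFlip G H u v w) :
    IsFlip G H v w u :=
  ⟨⟨h.vw, h.wu, h.uv, h.vv, h.ww, h.uu⟩, by rw [h.ind_eq]; abel⟩

theorem IsFlip.reach_of_adj_one {G H : LoopyGraph V} {u v w x : V} (hH : IsFlip G H u v w)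
    (hu : G.Adj u x) (hv : ¬ G.Adj v x) (hw : ¬ G.Adj w x) : Reach G H := by
  obtain ⟨⟨_, _, _⟩, _, _, _, _, _, _⟩ := hH.reversed_and_ne
  obtain ⟨⟨huv, hvw, hwu, huu, hvv, hww⟩, hH⟩ := hH
  have := G.symm _ _ hu
  have := mt (G.symm x v) hv
  have := mt (G.symm x w) hw
  have hxu : u ≠ x := by grind
  have hxv : v ≠ x := by grind
  have hxw : w ≠ x := by grind
  have := hxu.symm
  have := hxv.symm
  have := hxw.symm
  obtain ⟨G1, r1, h1⟩ := G.exists_loop u v x (by simp [G.ind_mk, *]) (by simp [G.ind_mk, *]) ‹_›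
    (by simp [G.ind_mk, *]) (by simp [G.ind_mk, *])
  obtain ⟨G2, r2, h2⟩ := G1.exists_loop v w x (by simp [G.ind_mk, single, *])
    (by simp [G.ind_mk, single, *]) ‹_› (by simp [G.ind_mk, single, *])
    (by simp [G.ind_mk, single, *])
  obtain ⟨G3, r3, h3⟩ := G2.exists_loop w u x (by simp [G.ind_mk, single, *])
    (by simp [G.ind_mk, single, *]) ‹_› (by simp [G.ind_mk, single, *])
    (by simp [G.ind_mk, single, *])
  have : G3 = H := by
    apply ind_injective
    rw [hH, h3, h2, h1]
    abel
  exact this ▸ (r1.trans r2).trans r3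

theorem IsFlip.reach_of_adj_two {G H : LoopyGraph V} {u v w x : V} (hH : IsFlip G H u v w)
    (hu : G.Adj u x) (hv : G.Adj v x) (hw : ¬ G.Adj w x) (hxw : w ≠ x) :
    Reach G H := by
  obtain ⟨⟨_, _, _⟩, _, _, _, _, _, _⟩ := hH.reversed_and_ne
  obtain ⟨⟨huv, hvw, hwu, huu, hvv, hww⟩, hH⟩ := hH
  have := G.symm _ _ hu
  have := G.symm _ _ hv
  have := mt (G.symm x w) hw
  have hxu : u ≠ x := by grind
  have hxv : v ≠ x := by grind
  have := hxu.symm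
  have := hxv.symm
  have := hxw.symm
  obtain ⟨G1, r1, h1⟩ := G.exists_loop u w x (by simp [G.ind_mk, *]) (by simp [G.ind_mk, *])
    ‹_› (by simp [G.ind_mk, *]) (by simp [G.ind_mk, *])
  obtain ⟨G2, r2, h2⟩ := G1.exists_loop v u x (by simp [G.ind_mk, single, *])
    (by simp [G.ind_mk, single, *]) ‹_› (by simp [G.ind_mk, single, *])
    (by simp [G.ind_mk, single, *])
  obtain ⟨G3, r3, h3⟩ := G2.exists_loop w v x (by simp [G.ind_mk, single, *])
    (by simp [G.ind_mk, single, *]) ‹_› (by simp [G.ind_mk, single, *])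
    (by simp [G.ind_mk, single, *])
  have : G3 = H := by
    apply ind_injective
    rw [hH, h3, h2, h1, single_comm v u, single_comm u w, single_comm w v]
    abel
  exact this ▸ (r1.trans r2).trans r3

theorem IsFlip.reach_of_disjoint_edge {G H : LoopyGraph V} {u v w x y : V}
    (hH : IsFlip G H u v w) (hxy : G.Adj x y) (hne : x ≠ y)
    (hux : ¬ G.Adj u x) (hvx : ¬ G.Adj v x) (hwx : ¬ G.Adj w x)
    (huy : ¬ G.Adj u y) (hvy : ¬ G.Adj v y) (hwy : ¬ G.Adj w y) : Reach G H := by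
  obtain ⟨⟨_, _, _⟩, _, _, _, _, _, _⟩ := hH.reversed_and_ne
  obtain ⟨⟨huv, hvw, hwu, huu, hvv, hww⟩, hH⟩ := hH
  have := G.symm _ _ hxy
  have := mt (G.symm x u) hux
  have := mt (G.symm x v) hvx
  have := mt (G.symm x w) hwx
  have := mt (G.symm y u) huy
  have := mt (G.symm y v) hvy
  have := mt (G.symm y w) hwy
  have hxu : u ≠ x := by grind
  have hxv : v ≠ x := by grind
  have hxw : w ≠ x := by grind
  have hyu : u ≠ y := by grind
  have hyv : v ≠ y := by grind
  have hyw : w ≠ y := by grind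
  have := hne.symm
  have := hxu.symm
  have := hxv.symm
  have := hxw.symm
  have := hyu.symm
  have := hyv.symm
  have := hyw.symm
  obtain ⟨G1, r1, h1⟩ := G.exists_swap u v x y (by simp [*]) (by simp [*])
    (by simp [*]) (by simp [*]) (by simp [*]) (by simp [*])
  obtain ⟨G2, r2, h2⟩ := G1.exists_loop w u v (by simp [G.ind_mk, single, *])
    (by simp [G.ind_mk, single, *]) ‹_› (by simp [G.ind_mk, single, *])
    (by simp [G.ind_mk, single, *])
  obtain ⟨G3, r3, h3⟩ := G2.exists_loop u v x (by simp [G.ind_mk, single, *])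
    (by simp [G.ind_mk, single, *]) ‹_› (by simp [G.ind_mk, single, *])
    (by simp [G.ind_mk, single, *])
  obtain ⟨G4, r4, h4⟩ := G3.exists_loop v x y (by simp [G.ind_mk, single, *])
    (by simp [G.ind_mk, single, *]) ‹_› (by simp [G.ind_mk, single, *])
    (by simp [G.ind_mk, single, *])
  have : G4 = H := by
    apply ind_injective
    rw [hH, h4, h3, h2, h1, single_comm w v]
    abel
  exact this ▸ ((r1.trans r2).trans r3).trans r4

theorem IsFlip.reach_of_not_adj {G H : LoopyGraph V} {u v w x y : V}
    (hH : IsFlip G H u v w) (hxy : ¬ G.Adj x y) (hne : x ≠ y)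
    (hux : G.Adj u x) (hvx : G.Adj v x) (hwx : G.Adj w x)
    (huy : G.Adj u y) (hvy : G.Adj v y) (hwy : G.Adj w y) : Reach G H := by
  obtain ⟨⟨_, _, _⟩, _, _, _, _, _, _⟩ := hH.reversed_and_ne
  obtain ⟨⟨huv, hvw, hwu, huu, hvv, hww⟩, hH⟩ := hH
  have := mt (G.symm y x) hxy
  have := G.symm _ _ hux
  have := G.symm _ _ hvx
  have := G.symm _ _ hwx
  have := G.symm _ _ huy
  have := G.symm _ _ hvy
  have := G.symm _ _ hwy
  have hxu : u ≠ x := by grind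
  have hxv : v ≠ x := by grind
  have hxw : w ≠ x := by grind
  have hyu : u ≠ y := by grind
  have hyv : v ≠ y := by grind
  have hyw : w ≠ y := by grind
  have := hne.symm
  have := hxu.symm
  have := hxv.symm
  have := hxw.symm
  have := hyu.symm
  have := hyv.symm
  have := hyw.symm
  obtain ⟨G1, r1, h1⟩ := G.exists_loop u x y (by simp [G.ind_mk, *]) (by simp [G.ind_mk, *])
    ‹_› (by simp [G.ind_mk, *]) (by simp [G.ind_mk, *])
  obtain ⟨G2, r2, h2⟩ := G1.exists_loop v u x (by simp [G.ind_mk, single, *])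
    (by simp [G.ind_mk, single, *]) ‹_› (by simp [G.ind_mk, single, *])
    (by simp [G.ind_mk, single, *])
  obtain ⟨G3, r3, h3⟩ := G2.exists_loop w v x (by simp [G.ind_mk, single, *])
    (by simp [G.ind_mk, single, *]) ‹_› (by simp [G.ind_mk, single, *])
    (by simp [G.ind_mk, single, *])
  obtain ⟨G4, r4, h4⟩ := G3.exists_swap x y w u
    (ind_eq_one.1 (by simp [G.ind_mk, single, *]))
    (ind_eq_one.1 (by simp [G.ind_mk, single, *])) (by simp [*])
    (ind_eq_zero.1 (by simp [G.ind_mk, single, *]))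
    (ind_eq_zero.1 (by simp [G.ind_mk, single, *])) (by simp [*])
  have : G4 = H := by
    apply ind_injective
    rw [hH, h4, h3, h2, h1, single_comm v u, single_comm w v, single_comm y u, single_comm w x]
    abel
  exact this ▸ ((r1.trans r2).trans r3).trans r4

/-- A loop outside a triangle can trade places with one of the triangle's vertices. -/
theorem IsFlip.exists_reach_isFlip {G H : LoopyGraph V} {u v w b : V} (hH : IsFlip G H u v w)
    (hb : G.Adj b b) (hub : ¬ G.Adj u b) (hvb : ¬ G.Adj v b) (hwb : ¬ G.Adj w b) :
    ∃ G' : LoopyGraph V, Reach G G' ∧ IsFlip G' H u v b ∧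
      G'.ind = G.ind - single b b - single u w - single v w +
        single u b + single v b + single w w := by
  obtain ⟨⟨_, _, _⟩, _, _, _, _, _, _⟩ := hH.reversed_and_ne
  obtain ⟨⟨huv, hvw, hwu, huu, hvv, hww⟩, hH⟩ := hH
  have := mt (G.symm b u) hub
  have := mt (G.symm b v) hvb
  have := mt (G.symm b w) hwb
  have hbu : u ≠ b := by grind
  have hbv : v ≠ b := by grind
  have hbw : w ≠ b := by grind
  have := hbu.symm
  have := hbv.symm
  have := hbw.symm
  obtain ⟨G1, r1, h1⟩ := G.exists_unloop b u v (by simp [G.ind_mk, *]) (by simp [G.ind_mk, *])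
    ‹_› (by simp [G.ind_mk, *]) (by simp [G.ind_mk, *])
  obtain ⟨G2, r2, h2⟩ := G1.exists_loop w u v (by simp [G.ind_mk, single, *])
    (by simp [G.ind_mk, single, *]) ‹_› (by simp [G.ind_mk, single, *])
    (by simp [G.ind_mk, single, *])
  have h : G2.ind = G.ind - single b b - single u w - single v w +
        single u b + single v b + single w w := by
    rw [h2, h1, single_comm w v, single_comm w u, single_comm b u, single_comm b v]
    abel
  refine ⟨G2, r1.trans r2, ⟨⟨?_, ?_, ?_, ?_, ?_, ?_⟩, ?_⟩, h⟩
  all_goals try rw [← ind_eq_one]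
  any_goals simp [G.ind_mk, single, *]; done
  rw [hH, h, single_comm b u, single_comm w u]
  abel

theorem DoubleEdgeSwap.symm {G H : LoopyGraph V} (h : DoubleEdgeSwap G H) :
    DoubleEdgeSwap H G := by
  obtain ⟨u, v, x, y, huv, hxy, hne, hux, hvy, hne', h⟩ := h
  have hs : ∀ a b c d, s(a, b) = s(c, d) → (G.Adj a b ↔ G.Adj c d) := by
    intro a b c d hh
    rw [← ind_eq_one, ← ind_eq_one, hh]
  refine ⟨u, x, v, y, by simp [h], by simp [h], hne', ?_, ?_, hne, fun a b => ?_⟩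
  · rw [h]; grind
  · rw [h]; grind
  · rw [h]
    have := hs a b u v
    have := hs a b x y
    have := hs a b u x
    have := hs a b v y
    grind

theorem Reach.symm {G H : LoopyGraph V} (h : Reach G H) : Reach H G :=
  (@Relation.ReflTransGen.stdSymm _ _ ⟨fun _ _ => DoubleEdgeSwap.symm⟩).symm _ _ h

theorem IsFlip.exists_loop {G H : LoopyGraph V} {u v w a : V} (hH : IsFlip G H u v w)
    (ha : ¬ G.Adj a a) (hu : G.Adj u a) (hv : G.Adj v a) (hw : G.Adj w a) :
    ∃ K : LoopyGraph V, Reach H K ∧ K.ind = H.ind - single a u - single a v +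
      single a a + single u v := by
  obtain ⟨⟨_, _, _⟩, _, _, _, _, _, _⟩ := hH.reversed_and_ne
  obtain ⟨⟨huv, hvw, hwu, huu, hvv, hww⟩, hH⟩ := hH
  have := G.symm _ _ hu
  have := G.symm _ _ hv
  have := G.symm _ _ hw
  have hau : u ≠ a := by grind
  have hav : v ≠ a := by grind
  have haw : w ≠ a := by grind
  have := hau.symm
  have := hav.symm
  have := haw.symm
  exact H.exists_loop a u v (by simp [G.ind_mk, single, *]) (by simp [G.ind_mk, single, *])
    ‹_› (by simp [G.ind_mk, single, *]) (by simp [G.ind_mk, single, *])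

/-- All triangles in a loop-free clique have mutually reachable flips. -/
theorem IsFlip.reach_of_clique {G H H' : LoopyGraph V} {u v w a : V} (hH : IsFlip G H u v w)
    (hH' : IsFlip G H' u v a) (hw : G.Adj w a) : Reach H' H := by
  obtain ⟨K, rK, hK⟩ := hH.exists_loop hH'.ww (G.symm _ _ hH'.wu) hH'.vw hw
  obtain ⟨K', rK', hK'⟩ := hH'.exists_loop hH.ww (G.symm _ _ hH.wu) hH.vw (G.symm _ _ hw)
  have : K = K' := by
    apply ind_injective
    rw [hK, hK', hH.ind_eq, hH'.ind_eq, single_comm v a, single_comm v w]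
    abel
  subst this
  exact rK'.trans rK.symm

theorem exists_isFlip {G : LoopyGraph V} {u v w : V} (h : G.IsTriangle u v w) :
    ∃ H, IsFlip G H u v w := by
  obtain ⟨⟨hvu, hwv, huw⟩, n1, n2, n3, n4, n5, n6⟩ := h.reversed_and_ne
  let H : LoopyGraph V :=
    { Adj := fun a b => (G.Adj a b ∧ s(a, b) ≠ s(u, v) ∧ s(a, b) ≠ s(v, w) ∧ s(a, b) ≠ s(w, u)) ∨
        s(a, b) = s(u, u) ∨ s(a, b) = s(v, v) ∨ s(a, b) = s(w, w)
      symm := fun a b h => by rwa [Sym2.eq_swap (a := b), adj_comm] }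
  refine ⟨H, h, ?_⟩
  obtain ⟨huv, hvw, hwu, huu, hvv, hww⟩ := h
  rw [← ind_eq_one] at huv hvw hwu
  rw [← ind_eq_zero] at huu hvv hww
  ext e
  induction e with | _ a b
  have hH : H.ind s(a, b) = if (G.ind s(a, b) = 1 ∧ s(a, b) ≠ s(u, v) ∧ s(a, b) ≠ s(v, w) ∧
      s(a, b) ≠ s(w, u)) ∨ s(a, b) = s(u, u) ∨ s(a, b) = s(v, v) ∨ s(a, b) = s(w, w)
      then 1 else 0 := by
    simp only [ind_mk H, ind_eq_one, H]
    congr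
  have h01 : G.ind s(a, b) = 0 ∨ G.ind s(a, b) = 1 := by
    rw [ind_mk]; split_ifs <;> simp
  have e1 : s(u, v) ≠ s(v, w) := by simp [*]
  have e2 : s(v, w) ≠ s(w, u) := by simp [*]
  have e3 : s(w, u) ≠ s(u, v) := by simp [*]
  have e4 : s(u, u) ≠ s(v, v) := by simp [*]
  have e5 : s(v, v) ≠ s(w, w) := by simp [*]
  have e6 : s(w, w) ≠ s(u, u) := by simp [*]
  simp only [Pi.add_apply, Pi.sub_apply, hH, single]
  generalize s(a, b) = e at *
  grind

/-- A triangle whose flip cannot be simulated by double edge swaps. -/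
def IsBad (G : LoopyGraph V) (u v w : V) : Prop :=
  ∃ H, IsFlip G H u v w ∧ ¬ Reach G H

theorem IsBad.rotate {G : LoopyGraph V} {u v w : V} (h : G.IsBad u v w) : G.IsBad v w u :=
  let ⟨H, hH, hr⟩ := h
  ⟨H, hH.rotate, hr⟩

theorem IsBad.isTriangle {G : LoopyGraph V} {u v w : V} (h : G.IsBad u v w) :
    G.IsTriangle u v w :=
  let ⟨_, hH, _⟩ := h
  hH.toIsTriangle

theorem IsBad.adj_of_adj {G : LoopyGraph V} {u v w x : V} (h : G.IsBad u v w)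
    (hu : G.Adj u x) (hv : v ≠ x) (hw : w ≠ x) : G.Adj v x ∧ G.Adj w x := by
  obtain ⟨H, hH, hr⟩ := h
  by_cases h1 : G.Adj v x
  · by_cases h2 : G.Adj w x
    · exact ⟨h1, h2⟩
    · exact (hr (hH.reach_of_adj_two hu h1 h2 hw)).elim
  · by_cases h2 : G.Adj w x
    · exact (hr (hH.rotate.rotate.reach_of_adj_two h2 hu h1 hv)).elim
    · exact (hr (hH.reach_of_adj_one hu h1 h2)).elim

theorem IsBad.not_adj {G : LoopyGraph V} {u v w x y : V} (h : G.IsBad u v w)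
    (hx : ¬ G.Adj u x) (hxu : x ≠ u) (hy : ¬ G.Adj u y) (hyu : y ≠ u) (hxy : x ≠ y) :
    ¬ G.Adj x y := by
  have t := h.isTriangle
  have key : ∀ z, ¬ G.Adj u z → z ≠ u → ¬ G.Adj v z ∧ ¬ G.Adj w z := by
    intro z hz hzu
    have hzv : v ≠ z := fun e => hz (e ▸ t.uv)
    have hzw : w ≠ z := fun e => hz (e ▸ G.symm _ _ t.wu)
    exact ⟨fun h1 => hz (h.rotate.adj_of_adj h1 hzw hzu.symm).2,
      fun h1 => hz (h.rotate.rotate.adj_of_adj h1 hzu.symm hzv).1⟩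
  intro hadj
  obtain ⟨H, hH, hr⟩ := h
  exact hr (hH.reach_of_disjoint_edge hadj hxy hx (key x hx hxu).1 (key x hx hxu).2
    hy (key y hy hyu).1 (key y hy hyu).2)

theorem IsBad.adj {G : LoopyGraph V} {u v w x y : V} (h : G.IsBad u v w)
    (hx : G.Adj u x) (hy : G.Adj u y) (hxy : x ≠ y) : G.Adj x y := by
  have t := h.isTriangle
  by_cases hxv : v = x
  · subst hxv
    by_cases hyw : w = y
    · exact hyw ▸ t.vw
    · exact (h.adj_of_adj hy hxy hyw).1
  by_cases hxw : w = x
  · subst hxw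
    by_cases hyv : v = y
    · exact hyv ▸ G.symm _ _ t.vw
    · exact (h.adj_of_adj hy hyv hxy).2
  by_cases hyv : v = y
  · subst hyv
    exact G.symm _ _ (h.adj_of_adj hx hxv hxw).1
  by_cases hyw : w = y
  · subst hyw
    exact G.symm _ _ (h.adj_of_adj hx hxv hxw).2
  have h1 := h.adj_of_adj hx hxv hxw
  have h2 := h.adj_of_adj hy hyv hyw
  obtain ⟨H, hH, hr⟩ := h
  by_contra hadj
  exact hr (hH.reach_of_not_adj hadj hxy hx h1.1 h1.2 hy h2.1 h2.2)

/-- A looped vertex off a bad triangle is joined to every neighbor of the triangle. -/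
theorem IsBad.adj_loop {G : LoopyGraph V} {u v w a b : V} (h : G.IsBad u v w)
    (ha : G.Adj u a) (hav : a ≠ v) (haw : a ≠ w) (hb : G.Adj b b) (hub : ¬ G.Adj u b) :
    G.Adj b a := by
  have t := h.isTriangle
  obtain ⟨⟨_, _, _⟩, _, _, _, _, _, _⟩ := t.reversed_and_ne
  have hbu : u ≠ b := fun e => t.uu (e ▸ hb)
  have hbv : v ≠ b := fun e => t.vv (e ▸ hb)
  have hbw : w ≠ b := fun e => t.ww (e ▸ hb)
  have hab : a ≠ b := fun e => hub (e ▸ ha)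
  have hau : u ≠ a := fun e => t.uu (by rwa [← e] at ha)
  have hvb : ¬ G.Adj v b := fun h1 => hub (h.rotate.adj_of_adj h1 hbw hbu).2
  have hwb : ¬ G.Adj w b := fun h1 => hub (h.rotate.rotate.adj_of_adj h1 hbu hbv).1
  obtain ⟨H, hH, hr⟩ := h
  obtain ⟨G', r, hH', hi⟩ := hH.exists_reach_isFlip hb hub hvb hwb
  have bad : G'.IsBad u v b := ⟨H, hH', fun h1 => hr (r.trans h1)⟩
  have hua : G'.Adj u a := by
    rw [← ind_eq_one, hi]
    simp [G.ind_mk, single, *]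
  have := (bad.adj_of_adj hua hav.symm hab.symm).2
  rw [← ind_eq_one, hi] at this
  by_contra hba
  have hau' := hau.symm
  simp [G.ind_mk, single, *] at this

/-- A loop-free neighbor of a bad triangle has no neighbors off the neighborhood of the
triangle. -/
theorem IsBad.adj_of_loopfree {G : LoopyGraph V} {u v w a b : V} (h : G.IsBad u v w)
    (ha : G.Adj u a) (hav : a ≠ v) (haw : a ≠ w) (haa : ¬ G.Adj a a) (hab : G.Adj a b)
    (hbu : b ≠ u) : G.Adj u b := by
  have t := h.isTriangle
  by_cases hbv : b = v
  · exact hbv ▸ t.uv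
  obtain ⟨hva, hwa⟩ := h.adj_of_adj ha hav.symm haw.symm
  obtain ⟨H, hH, hr⟩ := h
  obtain ⟨H', hH'⟩ := exists_isFlip (G := G) (u := u) (v := v) (w := a)
    ⟨t.uv, hva, G.symm _ _ ha, t.uu, t.vv, haa⟩
  have bad : G.IsBad u v a := ⟨H', hH', fun h1 => hr (h1.trans (hH.reach_of_clique hH' hwa))⟩
  exact (bad.rotate.rotate.adj_of_adj hab hbu.symm (Ne.symm hbv)).1

theorem mem_Vset_one {G : LoopyGraph V} {z : V} :
    z ∈ Vset G 1 ↔ G.Adj z z ∧ ∃ y, ¬ G.Adj y y ∧ G.Adj z y := by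
  simp only [Vset, within, Set.mem_sdiff, Set.mem_union, Set.mem_ofPred_eq]
  tauto

theorem mem_within_one {G : LoopyGraph V} {z : V} :
    z ∈ within G 1 ↔ ¬ G.Adj z z ∨ z ∈ Vset G 1 := by
  simp only [mem_Vset_one, within, Set.mem_union, Set.mem_ofPred_eq]
  tauto

theorem IsBad.adj_of_adj_loopfree {G : LoopyGraph V} {u v w a b : V} (h : G.IsBad u v w)
    (ha : G.Adj u a) (haa : ¬ G.Adj a a) (hab : G.Adj a b) (hbu : b ≠ u) : G.Adj u b := by
  have t := h.isTriangle
  by_cases hbv : b = v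
  · exact hbv ▸ t.uv
  by_cases hbw : b = w
  · exact hbw ▸ G.symm _ _ t.wu
  by_cases hav : a = v
  · subst hav
    exact (h.rotate.adj_of_adj hab (Ne.symm hbw) hbu.symm).2
  by_cases haw : a = w
  · subst haw
    exact (h.rotate.rotate.adj_of_adj hab hbu.symm (Ne.symm hbv)).1
  exact h.adj_of_loopfree ha hav haw haa hab hbu

theorem IsBad.mem_Vset_one {G : LoopyGraph V} {u v w z : V} (h : G.IsBad u v w) :
    z ∈ Vset G 1 ↔ G.Adj z z ∧ G.Adj u z := by
  have t := h.isTriangle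
  rw [LoopyGraph.mem_Vset_one]
  refine and_congr_right fun hz => ⟨?_, fun huz => ⟨u, t.uu, G.symm _ _ huz⟩⟩
  rintro ⟨y, hy, hzy⟩
  have hzu : z ≠ u := fun e => t.uu (e ▸ hz)
  by_contra huz
  by_cases huy : G.Adj u y
  · exact huz (h.adj_of_adj_loopfree huy hy (G.symm _ _ hzy) hzu)
  · refine h.not_adj huz hzu huy ?_ ?_ hzy
    · rintro rfl
      exact huz (G.symm _ _ hzy)
    · rintro rfl
      exact hy hz

theorem IsBad.not_adj_loopfree {G : LoopyGraph V} {u v w z y : V} (h : G.IsBad u v w)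
    (hz : ¬ G.Adj z z) (hzu : z ≠ u) (huz : ¬ G.Adj u z) (hy : ¬ G.Adj y y) : ¬ G.Adj z y := by
  intro hzy
  by_cases huy : G.Adj u y
  · exact huz (h.adj_of_adj_loopfree huy hy (G.symm _ _ hzy) hzu)
  · refine h.not_adj huz hzu huy ?_ ?_ hzy
    · rintro rfl
      exact huz (G.symm _ _ hzy)
    · rintro rfl
      exact hz hzy

theorem IsBad.isClique {G : LoopyGraph V} {u v w : V} (h : G.IsBad u v w) :
    G.IsClique {z | z = u ∨ G.Adj u z} := by
  rintro x (rfl | hx) y (rfl | hy) hxy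
  · exact (hxy rfl).elim
  · exact hy
  · exact G.symm _ _ hx
  · exact h.adj hx hy hxy

theorem IsBad.q1 [Finite V] {G : LoopyGraph V} {u v w a : V} (h : G.IsBad u v w)
    (ha : G.Adj u a) (hav : a ≠ v) (haw : a ≠ w) (haa : ¬ G.Adj a a) : Q1 G := by
  have t := h.isTriangle
  obtain ⟨⟨_, _, huw⟩, n1, n2, n3, n4, n5, n6⟩ := t.reversed_and_ne
  have hau : a ≠ u := fun e => t.uu (by rwa [e] at ha)
  have hloop : ∀ z, G.Adj z z → G.Adj u z := by
    intro z hz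
    by_contra huz
    exact huz (h.adj_of_adj_loopfree ha haa (G.symm _ _ (h.adj_loop ha hav haw hz huz))
      (fun e => t.uu (e ▸ hz)))
  have hwithin : ∀ z, z ∈ within G 1 := by
    intro z
    rw [mem_within_one, h.mem_Vset_one]
    have := hloop z
    tauto
  refine ⟨{z | z = u ∨ G.Adj u z} ∩ {z | ¬ G.Adj z z}, Set.inter_subset_right, ?_, ?_, ?_, ?_,
    ?_, ?_⟩
  · have : ({u, v, w, a} : Set V).ncard = 4 := by
      rw [Set.ncard_eq_succ]
      refine ⟨u, {v, w, a}, by simp [*, hau.symm], rfl, ?_⟩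
      rw [Set.ncard_eq_succ]
      refine ⟨v, {w, a}, by simp [*, hav.symm], rfl, Set.ncard_pair haw.symm⟩
    rw [← this]
    refine Set.ncard_le_ncard ?_
    rintro z (rfl | rfl | rfl | rfl)
    exacts [⟨.inl rfl, t.uu⟩, ⟨.inr t.uv, t.vv⟩, ⟨.inr huw, t.ww⟩, ⟨.inr ha, haa⟩]
  · exact fun x hx y hy => h.isClique x hx.1 y hy.1
  · intro z hz
    by_cases hK : z = u ∨ G.Adj u z
    · exact .inr ⟨hK, hz⟩
    · rw [not_or] at hK
      exact .inl fun y hy => h.not_adj_loopfree hz hK.1 hK.2 hy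
  · have hsub : Vset G 1 ∪ {z | z = u ∨ G.Adj u z} ∩ {z | ¬ G.Adj z z} ⊆
        {z | z = u ∨ G.Adj u z} :=
      Set.union_subset (fun z hz => .inr (h.mem_Vset_one.1 hz).2) Set.inter_subset_left
    exact fun x hx y hy => h.isClique x (hsub hx) y (hsub hy)
  · exact Set.eq_empty_of_forall_notMem fun z hz => hz.2 (hwithin z)
  · exact Set.eq_empty_of_forall_notMem fun z hz => hz 1 (hwithin z)

theorem IsBad.ncard_nbr {G : LoopyGraph V} {u v w : V} (h : G.IsBad u v w)
    (hl : ∀ a, G.Adj u a → a ≠ v → a ≠ w → G.Adj a a) :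
    (nbr G u ∩ Vset G 0).ncard = 2 := by
  have t := h.isTriangle
  obtain ⟨⟨_, _, huw⟩, n1, n2, n3, n4, n5, n6⟩ := t.reversed_and_ne
  rw [← Set.ncard_pair n2]
  congr 1
  ext z
  constructor
  · rintro ⟨⟨-, hz⟩, hz0⟩
    by_contra hzvw
    simp only [Set.mem_insert_iff, Set.mem_singleton_iff, not_or] at hzvw
    exact hz0 (hl z hz hzvw.1 hzvw.2)
  · rintro (rfl | rfl)
    exacts [⟨⟨n4, t.uv⟩, t.vv⟩, ⟨⟨n3, huw⟩, t.ww⟩]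

theorem IsBad.q2 [Finite V] {G : LoopyGraph V} {u v w : V} (h : G.IsBad u v w)
    (hl : ∀ a, G.Adj u a → a ≠ v → a ≠ w → G.Adj a a) : Q2 G := by
  have t := h.isTriangle
  obtain ⟨⟨_, _, huw⟩, n1, n2, n3, n4, n5, n6⟩ := t.reversed_and_ne
  have cu := h.ncard_nbr hl
  have cv := h.rotate.ncard_nbr fun a ha haw hau =>
    hl a (h.rotate.adj_of_adj ha haw.symm hau.symm).2 (fun e => t.vv (e ▸ ha)) haw
  have cw := h.rotate.rotate.ncard_nbr fun a ha hau hav =>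
    hl a (h.rotate.rotate.adj_of_adj ha hau.symm hav.symm).1 hav (fun e => t.ww (e ▸ ha))
  have hout : ∀ z, G.Adj z z → z ∉ Vset G 1 → nbr G z = Vset G 1 := by
    intro z hz hz1
    have huz : ¬ G.Adj u z := fun h1 => hz1 (h.mem_Vset_one.2 ⟨hz, h1⟩)
    have hzu : z ≠ u := fun e => t.uu (e ▸ hz)
    ext y
    constructor
    · rintro ⟨hyz, hzy⟩
      have huy : G.Adj u y := by
        by_contra huy
        refine h.not_adj huz hzu huy ?_ hyz.symm hzy
        rintro rfl
        exact huz (G.symm _ _ hzy)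
      refine h.mem_Vset_one.2 ⟨?_, huy⟩
      by_contra hyy
      exact huz (h.adj_of_adj_loopfree huy hyy (G.symm _ _ hzy) hzu)
    · intro hy
      obtain ⟨hyy, huy⟩ := h.mem_Vset_one.1 hy
      exact ⟨fun e => huz (e ▸ huy), h.adj_loop huy (fun e => t.vv (e ▸ hyy))
        (fun e => t.ww (e ▸ hyy)) hz huz⟩
  have hloop : ∀ z, z ∉ within G 1 → G.Adj z z ∧ z ∉ Vset G 1 := by
    intro z hz
    rw [mem_within_one] at hz
    tauto
  refine ⟨?_, ?_, ?_, ?_, ?_, ?_⟩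
  · have : ({u, v, w} : Set V).ncard = 3 := by
      rw [Set.ncard_eq_succ]
      exact ⟨u, {v, w}, by simp [*], rfl, Set.ncard_pair n2⟩
    rw [← this]
    refine Set.ncard_le_ncard ?_
    rintro z (rfl | rfl | rfl)
    exacts [⟨t.uu, cu⟩, ⟨t.vv, cv⟩, ⟨t.ww, cw⟩]
  · intro z hz
    have hadj : ∀ y ∈ Vset G 1, G.Adj u y ∧ G.Adj v y ∧ G.Adj w y := by
      intro y hy
      obtain ⟨hyy, huy⟩ := h.mem_Vset_one.1 hy
      exact ⟨huy, h.adj_of_adj huy (fun e => t.vv (e ▸ hyy)) (fun e => t.ww (e ▸ hyy))⟩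
    by_cases hzu : z = u
    · exact .inr ⟨hzu ▸ cu, fun y hy => hzu ▸ (hadj y hy).1⟩
    by_cases hzv : z = v
    · exact .inr ⟨hzv ▸ cv, fun y hy => hzv ▸ (hadj y hy).2.1⟩
    by_cases hzw : z = w
    · exact .inr ⟨hzw ▸ cw, fun y hy => hzw ▸ (hadj y hy).2.2⟩
    exact .inl fun y hy => h.not_adj_loopfree hz hzu (fun h1 => hz (hl z h1 hzv hzw)) hy
  · exact fun x hx y hy => h.isClique x (.inr (h.mem_Vset_one.1 hx).2) y
      (.inr (h.mem_Vset_one.1 hy).2)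
  · rintro z ⟨-, hz⟩
    exact hout z (hloop z hz).1 (hloop z hz).2
  · refine Set.eq_empty_of_forall_notMem ?_
    rintro z ⟨hz | ⟨y, hy, hzy⟩, hz2⟩
    · exact hz2 hz
    have hz1 : z ∉ within G 1 := fun h1 => hz2 (.inl h1)
    have hy1 : y ∉ within G 1 := fun h1 => hz2 (.inr ⟨y, h1, hzy⟩)
    by_cases hyz : z = y
    · exact hz2 (hyz ▸ hy)
    have : z ∈ nbr G y := ⟨hyz, G.symm _ _ hzy⟩
    rw [hout y (hloop y hy1).1 (hloop y hy1).2] at this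
    exact (hloop z hz1).2 this
  · by_cases h1 : Vset G 1 = ∅
    · refine .inr ⟨h1, fun z hz => ?_⟩
      obtain ⟨hzz, hz1⟩ := hloop z (hz 1)
      simp [deg, hout z hzz hz1, h1, hzz]
    · refine .inl (Set.eq_empty_of_forall_notMem fun z hz => ?_)
      obtain ⟨y, hy⟩ := Set.nonempty_iff_ne_empty.2 h1
      obtain ⟨hzz, hz1⟩ := hloop z (hz 1)
      have : y ∈ nbr G z := by rwa [hout z hzz hz1]
      exact hz 2 (.inr ⟨y, mem_within_one.2 (.inr hy), this.2⟩)

theorem IsBad.q1_or_q2 [Finite V] {G : LoopyGraph V} {u v w : V} (h : G.IsBad u v w) :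
    Q1 G ∨ Q2 G := by
  by_cases hl : ∀ a, G.Adj u a → a ≠ v → a ≠ w → G.Adj a a
  · exact .inr (h.q2 hl)
  · push Not at hl
    obtain ⟨a, ha, hav, haw, haa⟩ := hl
    exact .inl (h.q1 ha hav haw haa)

/-- The degree of `z` with respect to an integer weighting of the edges. -/
noncomputable def wdeg [Fintype V] (f : Sym2 V → ℤ) (z : V) : ℤ := ∑ y, f s(z, y) + f s(z, z)

theorem wdeg_add [Fintype V] (f g : Sym2 V → ℤ) (z : V) :
    wdeg (f + g) z = wdeg f z + wdeg g z := by
  simp only [wdeg, Pi.add_apply, Finset.sum_add_distrib]; ring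

theorem wdeg_sub [Fintype V] (f g : Sym2 V → ℤ) (z : V) :
    wdeg (f - g) z = wdeg f z - wdeg g z := by
  simp only [wdeg, Pi.sub_apply, Finset.sum_sub_distrib]; ring

theorem wdeg_single [Fintype V] (a b z : V) :
    wdeg (single a b) z = (if z = a then 1 else 0) + (if z = b then 1 else 0) := by
  by_cases hza : z = a
  · subst hza
    have : ∀ y, single z b s(z, y) = if y = b then 1 else 0 := by
      intro y; simp only [single, Sym2.eq_iff]; grind
    simp [wdeg, this]
  · by_cases hzb : z = b
    · subst hzb
      have : ∀ y, single a z s(z, y) = if y = a then 1 else 0 := by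
        intro y; simp [single, hza]
      simp [wdeg, this, hza]
    · simp [wdeg, single, hza, hzb]

theorem deg_eq_wdeg [Fintype V] (G : LoopyGraph V) (z : V) : (G.deg z : ℤ) = wdeg G.ind z := by
  have h : (G.nbr z).ncard = ∑ y ∈ Finset.univ.erase z, G.ind s(z, y) := by
    rw [Set.ncard_eq_toFinset_card', Finset.card_eq_sum_ones, Nat.cast_sum]
    have : (G.nbr z).toFinset = (Finset.univ.erase z).filter (fun y => G.Adj z y) := by
      ext y; rw [Set.mem_toFinset]; simp [nbr]
    rw [this, Finset.sum_filter]
    simp [ind_mk]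
  rw [deg, Nat.cast_add, h, wdeg, ← Finset.sum_erase_add _ _ (Finset.mem_univ z), ind_mk G z z]
  split_ifs <;> simp
  ring

theorem DoubleEdgeSwap.deg_eq [Fintype V] {G H : LoopyGraph V} (h : DoubleEdgeSwap G H) (z : V) :
    H.deg z = G.deg z := by
  obtain ⟨u, v, x, y, huv, hxy, hne, hux, hvy, hne', hH⟩ := h
  zify
  simp only [deg_eq_wdeg, ind_of_swap huv hxy hne hux hvy hne' hH, wdeg_add, wdeg_sub,
    wdeg_single]
  ring

theorem Reach.deg_eq [Fintype V] {G H : LoopyGraph V} (h : Reach G H) (z : V) :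
    H.deg z = G.deg z := by
  induction h with
  | refl => rfl
  | tail _ h ih => rw [h.deg_eq, ih]

theorem IsFlip.deg_eq [Fintype V] {G H : LoopyGraph V} {u v w : V} (h : IsFlip G H u v w) (z : V) :
    H.deg z = G.deg z := by
  zify
  simp only [deg_eq_wdeg, h.ind_eq, wdeg_add, wdeg_sub, wdeg_single]
  ring

/-- The vertices joined to `z` in `G` but not in `H`. -/
noncomputable def only [Fintype V] (G H : LoopyGraph V) (z : V) : Finset V :=
  {y | G.Adj z y ∧ ¬ H.Adj z y}

theorem mem_only [Fintype V] {G H : LoopyGraph V} {y z : V} :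
    y ∈ only G H z ↔ G.Adj z y ∧ ¬ H.Adj z y := by
  simp [only]

theorem mem_only_comm [Fintype V] {G H : LoopyGraph V} {y z : V} :
    y ∈ only G H z ↔ z ∈ only G H y := by
  rw [mem_only, mem_only, G.adj_comm, H.adj_comm]

theorem card_only [Fintype V] {G H : LoopyGraph V} {z : V} (h : G.deg z = H.deg z) :
    (only G H z).card + (if z ∈ only G H z then 1 else 0) =
      (only H G z).card + (if z ∈ only H G z then 1 else 0) := by
  have key : ∀ y, G.ind s(z, y) - H.ind s(z, y) =
      (if y ∈ only G H z then 1 else 0) - (if y ∈ only H G z then 1 else 0) := by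
    intro y
    simp only [mem_only, ind_mk]
    by_cases h1 : G.Adj z y <;> by_cases h2 : H.Adj z y <;> simp [h1, h2]
  zify at h
  rw [deg_eq_wdeg, deg_eq_wdeg, ← sub_eq_zero, ← wdeg_sub, wdeg] at h
  simp only [Pi.sub_apply, key, Finset.sum_sub_distrib, Finset.sum_ite_mem, Finset.univ_inter,
    Finset.sum_const, nsmul_eq_mul, mul_one] at h
  zify
  linarith

/-- The edges on which `G` and `H` differ. -/
def edgeDiff (G H : LoopyGraph V) : Set (Sym2 V) := {e | G.ind e ≠ H.ind e}

theorem edgeDiff_comm (G H : LoopyGraph V) : edgeDiff G H = edgeDiff H G := by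
  ext e; exact ne_comm

theorem ncard_lt_of_subset_insert {α : Type*} [Finite α] {S T : Set α} {a b c d : α}
    (h : T ⊆ insert a (S \ {b, c, d})) (hb : b ∈ S) (hc : c ∈ S) (hd : d ∈ S) (hbc : b ≠ c)
    (hbd : b ≠ d) (hcd : c ≠ d) : T.ncard < S.ncard := by
  have h3 : ({b, c, d} : Set α).ncard = 3 := by
    rw [Set.ncard_eq_succ]
    exact ⟨b, {c, d}, by simp [*], rfl, Set.ncard_pair hcd⟩
  have hsub : ({b, c, d} : Set α) ⊆ S := by
    rintro x (rfl | rfl | rfl) <;> assumption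
  have h1 := Set.ncard_le_ncard h
  have h2 := Set.ncard_insert_le a (S \ {b, c, d})
  have h4 := Set.ncard_sdiff_add_ncard_of_subset hsub
  omega

/-- No swap of `G` or of `H` brings the two graphs closer together. -/
def Stuck (G H : LoopyGraph V) : Prop :=
  (∀ K, Reach G K → (edgeDiff G H).ncard ≤ (edgeDiff K H).ncard) ∧
    ∀ K, Reach H K → (edgeDiff G H).ncard ≤ (edgeDiff G K).ncard

theorem Stuck.symm {G H : LoopyGraph V} (h : Stuck G H) : Stuck H G := by
  refine ⟨fun K hK => ?_, fun K hK => ?_⟩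
  · rw [edgeDiff_comm H, edgeDiff_comm K]
    exact h.2 K hK
  · rw [edgeDiff_comm H, edgeDiff_comm H]
    exact h.1 K hK

theorem Stuck.mem_only_of_path [Fintype V] {G H : LoopyGraph V} (h : Stuck G H) {a b c d : V}
    (hab : b ∈ only G H a) (hbc : c ∈ only H G b) (hcd : d ∈ only G H c)
    (h1 : s(a, b) ≠ s(c, d)) (h2 : s(a, d) ≠ s(b, c)) : d ∈ only G H a := by
  rw [mem_only] at *
  obtain ⟨hab, hab'⟩ := hab
  obtain ⟨hbc, hbc'⟩ := hbc
  obtain ⟨hcd, hcd'⟩ := hcd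
  have h3 : s(a, b) ≠ s(b, c) := fun e => by
    rw [← ind_eq_one, e, ind_eq_one] at hab
    exact hbc' hab
  have h4 : s(c, d) ≠ s(b, c) := fun e => by
    rw [← ind_eq_one, e, ind_eq_one] at hcd
    exact hbc' hcd
  have mab : s(a, b) ∈ edgeDiff G H := by simp [edgeDiff, ind_mk, *]
  have mbc : s(b, c) ∈ edgeDiff G H := by simp [edgeDiff, ind_mk, *]
  have mcd : s(c, d) ∈ edgeDiff G H := by simp [edgeDiff, ind_mk, *]
  by_contra had
  by_cases hG : G.Adj a d
  · have hH : H.Adj a d := by tauto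
    obtain ⟨K, hK, hi⟩ := H.exists_swap a d b c hH hbc h2 hab' (mt (H.symm d c) hcd')
      (by rwa [Sym2.eq_swap (a := d)])
    refine (h.2 K hK).not_gt (ncard_lt_of_subset_insert (a := s(a, d)) ?_ mab mcd mbc h1 h3 h4)
    intro e he
    rw [← ind_eq_one] at hab hcd hH hG hbc
    rw [← ind_eq_zero] at hbc' hab' hcd'
    simp only [edgeDiff, hi, Set.mem_ofPred_eq, Pi.add_apply, Pi.sub_apply, single,
      Set.mem_insert_iff, Set.mem_sdiff, Set.mem_singleton_iff, Sym2.eq_swap (a := d)] at he ⊢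
    grind
  · obtain ⟨K, hK, hi⟩ := G.exists_swap a b d c hab (G.symm _ _ hcd)
      (by rwa [Sym2.eq_swap (a := d)]) hG hbc' h2
    refine (h.1 K hK).not_gt (ncard_lt_of_subset_insert (a := s(a, d)) ?_ mab mcd mbc h1 h3 h4)
    intro e he
    rw [← ind_eq_one] at hab hcd hbc
    rw [← ind_eq_zero] at hbc' hab' hcd' hG
    simp only [edgeDiff, hi, Set.mem_ofPred_eq, Pi.add_apply, Pi.sub_apply, single,
      Set.mem_insert_iff, Set.mem_sdiff, Set.mem_singleton_iff, Sym2.eq_swap (a := d)] at he ⊢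
    grind

theorem Stuck.not_alternating [Fintype V] {G H : LoopyGraph V} (h : Stuck G H)
    (hdeg : ∀ z, G.deg z = H.deg z) {a b c : V} (hab : b ∈ only G H a) (hbc : c ∈ only H G b)
    (hne : a ≠ b) (hne' : b ≠ c) (hac : a ≠ c) : False := by
  have hca : only G H c ⊆ only G H a := fun z hz => h.mem_only_of_path hab hbc hz (by grind) (by grind)
  have hac' : only H G a ⊆ only H G c := fun z hz =>
    h.symm.mem_only_of_path (mem_only_comm.1 hbc) (mem_only_comm.1 hab) hz (by grind) (by grind)
  have hbc' : b ∉ only G H c := fun hb => by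
    rw [mem_only_comm, mem_only] at hb
    exact (mem_only.1 hbc).2 hb.1
  have hba' : b ∉ only H G a := fun hb => (mem_only.1 hb).2 (mem_only.1 hab).1
  have h1 := Finset.card_lt_card (Finset.ssubset_iff_subset_ne.2 ⟨hca, fun e => hbc' (e ▸ hab)⟩)
  have h2 := Finset.card_lt_card
    (Finset.ssubset_iff_subset_ne.2 ⟨hac', fun e => hba' (e ▸ mem_only_comm.1 hbc)⟩)
  have h3 := card_only (hdeg a)
  have h4 := card_only (hdeg c)
  have h5 : c ∈ only G H c := by
    by_contra h5
    grind
  have h6 : a ∈ only H G a := by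
    by_contra h6
    grind
  exact (mem_only.1 (hac' h6)).2 ((mem_only_comm.1 (hca h5)) |> mem_only.1).1

/-- If `G` is stuck relative to `H`, an edge of `G` missing in `H` must be a loop. -/
theorem Stuck.eq_of_mem_only [Fintype V] {G H : LoopyGraph V} (h : Stuck G H)
    (hdeg : ∀ z, G.deg z = H.deg z) (hflip : ∀ K u v w, IsFlip G K u v w → Reach G K)
    {p q : V} (hpq : q ∈ only G H p) : p = q := by
  have key : ∀ {p q : V}, q ∈ only G H p → p ≠ q →
      p ∈ only H G p ∧ ∃ r ∈ only G H p, r ≠ p ∧ r ≠ q := by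
    intro p q hpq hne
    have hsub : only H G p ⊆ {p} := by
      intro z hz
      rw [Finset.mem_singleton]
      by_contra hzp
      refine h.not_alternating hdeg (mem_only_comm.1 hpq) hz hne.symm (Ne.symm hzp) ?_
      rintro rfl
      exact (mem_only.1 hz).2 (mem_only.1 hpq).1
    have h1 := card_only (hdeg p)
    have h2 := Finset.card_le_card hsub
    have h3 := Finset.card_pos.2 ⟨q, hpq⟩
    rw [Finset.card_singleton] at h2
    have hp : p ∈ only H G p := by
      by_contra hp
      have : only H G p = ∅ := Finset.eq_empty_of_forall_notMem fun z hz =>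
        hp (Finset.mem_singleton.1 (hsub hz) ▸ hz)
      simp only [this, Finset.card_empty] at h1
      grind
    have hp' : p ∉ only G H p := fun h' => (mem_only.1 h').2 (mem_only.1 hp).1
    have h4 := Finset.card_pos.2 ⟨p, hp⟩
    rw [if_neg hp', if_pos hp] at h1
    obtain ⟨r, hr, hrq⟩ := Finset.exists_mem_ne (s := only G H p) (by omega) q
    exact ⟨hp, r, hr, fun e => hp' (e ▸ hr), hrq⟩
  by_contra hne
  obtain ⟨hp, r, hpr, hrp, hrq⟩ := key hpq hne
  have hqr : r ∈ only G H q := h.mem_only_of_path (mem_only_comm.1 hpq) hp hpr (by grind) (by grind)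
  obtain ⟨hq, -⟩ := key hqr hrq.symm
  obtain ⟨hr, -⟩ := key (mem_only_comm.1 hqr) hrq
  rw [mem_only] at hp hpr hqr hq hr hpq
  obtain ⟨K, hK⟩ := exists_isFlip (G := G) (u := p) (v := q) (w := r)
    ⟨hpq.1, hqr.1, G.symm _ _ hpr.1, hp.2, hq.2, hr.2⟩
  refine (h.1 K (hflip K p q r hK)).not_gt (Set.ncard_lt_ncard
    ((Set.ssubset_iff_of_subset fun e he => ?_).2 ⟨s(p, q), ?_, ?_⟩))
  · simp only [← ind_eq_one, Sym2.eq_swap (a := p) (b := r)] at hp hpr hqr hq hr hpq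
    simp only [edgeDiff, hK.ind_eq, Set.mem_ofPred_eq, Pi.add_apply, Pi.sub_apply, single] at he ⊢
    grind
  · simp [edgeDiff, ind_mk, hpq]
  · have hqp := hpq.2
    rw [← ind_eq_zero] at hqp
    simp only [← ind_eq_one] at hpq
    simp only [edgeDiff, hK.ind_eq, Set.mem_ofPred_eq, Pi.add_apply, Pi.sub_apply, single, hqp,
      hpq.1, Sym2.eq_iff]
    grind

theorem Stuck.eq [Fintype V] {G H : LoopyGraph V} (h : Stuck G H)
    (hdeg : ∀ z, G.deg z = H.deg z) (hG : ∀ K u v w, IsFlip G K u v w → Reach G K)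
    (hH : ∀ K u v w, IsFlip H K u v w → Reach H K) : G = H := by
  have key : ∀ {G H : LoopyGraph V}, (∀ z, G.deg z = H.deg z) →
      (∀ {p q}, q ∈ only G H p → p = q) → (∀ {p q}, q ∈ only H G p → p = q) →
      ∀ p q, G.Adj p q → H.Adj p q := by
    intro G H hdeg h1 h2 p q hpq
    by_contra hpq'
    have hq : q ∈ only G H p := mem_only.2 ⟨hpq, hpq'⟩
    obtain rfl := h1 hq
    have h3 := card_only (hdeg p)
    have h4 : only H G p = ∅ := Finset.eq_empty_of_forall_notMem fun z hz => by
      obtain rfl := h2 hz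
      exact hpq' (mem_only.1 hz).1
    simp [h4, hq] at h3
  have h1 {p q} := h.eq_of_mem_only hdeg hG (p := p) (q := q)
  have h2 {p q} := h.symm.eq_of_mem_only (fun z => (hdeg z).symm) hH (p := p) (q := q)
  refine ind_injective (funext fun e => ?_)
  induction e with | _ a b
  have : G.Adj a b ↔ H.Adj a b :=
    ⟨key hdeg h1 h2 a b, key (fun z => (hdeg z).symm) h2 h1 a b⟩
  simp only [ind_mk, this]

theorem gConnected_of_flip [Fintype V] {k : V → ℕ}
    (hflip : ∀ (G H : LoopyGraph V) (u v w : V), (∀ z, G.deg z = k z) → IsFlip G H u v w →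
      Reach G H) : GConnected k := by
  intro G H hG hH
  induction hn : (edgeDiff G H).ncard using Nat.strong_induction_on generalizing G H with
  | _ n ih
  subst hn
  by_cases hs : Stuck G H
  · rw [hs.eq (fun z => (hG z).trans (hH z).symm) (fun K u v w => hflip G K u v w hG)
      (fun K u v w => hflip H K u v w hH)]
    exact .refl
  · rw [Stuck, not_and_or] at hs
    push Not at hs
    obtain ⟨K, hK, hlt⟩ | ⟨K, hK, hlt⟩ := hs
    · exact hK.trans (ih _ hlt K H (fun z => (hK.deg_eq z).trans (hG z)) hH rfl)
    · exact (ih _ hlt G K hG (fun z => (hK.deg_eq z).trans (hH z)) rfl).trans hK.symm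

/-- The subgraph of edges with both endpoints in `D`. -/
def restrict (G : LoopyGraph V) (D : Set V) : LoopyGraph V where
  Adj a b := G.Adj a b ∧ a ∈ D ∧ b ∈ D
  symm a b h := ⟨G.symm a b h.1, h.2.2, h.2.1⟩

/-- `A` is a clique with all self-loops, completely joined to `D`, and it contains all neighbors
of the vertices outside of `A ∪ D`. -/
structure IsSplit (G : LoopyGraph V) (A D : Set V) : Prop where
  clique : ∀ a ∈ A, ∀ b ∈ A, G.Adj a b
  join : ∀ a ∈ A, ∀ d ∈ D, G.Adj a d
  rest : ∀ z y, z ∉ A → z ∉ D → G.Adj z y → y ∈ A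

theorem IsSplit.endpoints {G : LoopyGraph V} {A D : Set V} (h : G.IsSplit A D) {u v x y : V}
    (huv : G.Adj u v) (hxy : G.Adj x y) (hux : ¬ G.Adj u x) (hvy : ¬ G.Adj v y) :
    ((u ∉ A ∧ v ∉ A ∧ x ∉ A ∧ y ∉ A) ∧ u ∈ D ∧ v ∈ D ∧ x ∈ D ∧ y ∈ D) ∨
      (u ∈ A ∧ v ∉ A ∧ v ∉ D ∧ x ∉ A ∧ x ∉ D ∧ y ∈ A) ∨
      (u ∉ A ∧ u ∉ D ∧ v ∈ A ∧ x ∈ A ∧ y ∉ A ∧ y ∉ D) := by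
  have edge : ∀ {a b}, G.Adj a b → a ∈ A ∨ a ∈ D ∨ b ∈ A := by
    intro a b hab
    by_contra hn
    exact hn (.inr (.inr (h.rest a b (fun h => hn (.inl h)) (fun h => hn (.inr (.inl h))) hab)))
  have nonedge : ∀ {a b}, ¬ G.Adj a b → a ∈ A → b ∉ A ∧ b ∉ D := fun hab ha =>
    ⟨fun hb => hab (h.clique _ ha _ hb), fun hb => hab (h.join _ ha _ hb)⟩
  have := edge huv
  have := edge (G.symm _ _ huv)
  have := edge hxy
  have := edge (G.symm _ _ hxy)
  have := nonedge hux
  have := nonedge (mt (G.symm x u) hux)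
  have := nonedge hvy
  have := nonedge (mt (G.symm y v) hvy)
  clear edge nonedge
  by_cases u ∈ A <;> by_cases v ∈ A <;> grind

theorem IsSplit.restrict_swap {G H : LoopyGraph V} {A D : Set V} (h : G.IsSplit A D)
    (hGH : DoubleEdgeSwap G H) :
    H.IsSplit A D ∧ Reach (G.restrict D) (H.restrict D) := by
  obtain ⟨u, v, x, y, huv, hxy, hne, hux, hvy, hne', hH⟩ := hGH
  have hcase := h.endpoints huv hxy hux hvy
  simp only [ne_eq, Sym2.eq_iff] at hH
  refine ⟨⟨fun a ha b hb => ?_, fun a ha d hd => ?_, fun z w hzA hzD hzw => ?_⟩, ?_⟩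
  · have := h.clique a ha b hb
    grind
  · have := h.join a ha d hd
    grind
  · have := h.rest z w hzA hzD
    grind
  · obtain hD | hA := hcase
    · refine .single ⟨u, v, x, y, ⟨huv, hD.2.1, hD.2.2.1⟩, ⟨hxy, hD.2.2.2⟩, hne,
        fun h => hux h.1, fun h => hvy h.1, hne', fun a b => ?_⟩
      simp only [restrict, hH, ne_eq, Sym2.eq_iff]
      grind
    · have : H.restrict D = G.restrict D := by
        refine ind_injective (funext fun e => ?_)
        induction e with | _ a b
        have : (H.restrict D).Adj a b ↔ (G.restrict D).Adj a b := by
          simp only [restrict, hH]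
          grind
        simp only [ind_mk, this]
      rw [this]
      exact .refl

theorem IsSplit.reach_restrict {G H : LoopyGraph V} {A D : Set V} (h : G.IsSplit A D)
    (hGH : Reach G H) : Reach (G.restrict D) (H.restrict D) := by
  suffices H.IsSplit A D ∧ Reach (G.restrict D) (H.restrict D) from this.2
  induction hGH with
  | refl => exact ⟨h, .refl⟩
  | tail _ hs ih =>
    have := ih.1.restrict_swap hs
    exact ⟨this.1, ih.2.trans this.2⟩

theorem IsSplit.not_reach {G H : LoopyGraph V} {A D : Set V} (h : G.IsSplit A D)
    (hswap : ∀ K, ¬ DoubleEdgeSwap (G.restrict D) K) (hne : G.restrict D ≠ H.restrict D) :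
    ¬ Reach G H := by
  intro hGH
  obtain he | ⟨K, hK, -⟩ := (h.reach_restrict hGH).cases_head
  · exact hne he
  · exact hswap K hK

theorem within_subset {G : LoopyGraph V} {k : ℕ} (h : Vset G (k + 1) = ∅) (m : ℕ) :
    within G m ⊆ within G k := by
  have hk : within G (k + 1) ⊆ within G k := Set.sdiff_eq_empty.1 h
  have hzero : within G 0 ⊆ within G k := by
    clear h hk
    induction k with
    | zero => exact subset_rfl
    | succ k ih => exact ih.trans Set.subset_union_left
  induction m with
  | zero => exact hzero
  | succ m ih =>
    rintro z (hz | ⟨u, hu, hzu⟩)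
    · exact ih hz
    · exact hk (Or.inr ⟨u, ih hu, hzu⟩)

theorem Q1.exists_not_reach [Fintype V] {G : LoopyGraph V} (h : Q1 G) :
    ∃ H : LoopyGraph V, (∀ z, H.deg z = G.deg z) ∧ ¬ Reach G H := by
  obtain ⟨K, hK0, hK4, hK, hiso, hclique, h2, hinf⟩ := h
  have hloop : ∀ z, G.Adj z z → z ∈ Vset G 1 := by
    intro z hz
    have hz' : z ∉ Vinf G := hinf ▸ Set.notMem_empty z
    simp only [Vinf, Set.mem_ofPred_eq, not_forall, not_not] at hz'
    obtain ⟨m, hm⟩ := hz'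
    obtain hm | hm := mem_within_one.1 (within_subset h2 m hm)
    · exact absurd hz hm
    · exact hm
  have hfree : ∀ z ∈ K, ¬ G.Adj z z := fun z hz => hK0 hz
  have hsplit : G.IsSplit (Vset G 1) K := by
    refine ⟨fun a ha b hb => ?_, fun a ha d hd => ?_, fun z y hzA hzD hzy => ?_⟩
    · by_cases hab : a = b
      · exact hab ▸ (mem_Vset_one.1 ha).1
      · exact hclique a (Or.inl ha) b (Or.inl hb) hab
    · refine hclique a (Or.inl ha) d (Or.inr hd) ?_
      rintro rfl
      exact hfree a hd (mem_Vset_one.1 ha).1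
    · have hz : z ∈ Vset G 0 := fun hz => hzA (hloop z hz)
      refine hloop y ?_
      by_contra hy
      exact ((hiso z hz).resolve_right hzD) y hy hzy
  obtain ⟨u, v, w, hu, hv, hw, huv, huw, hvw⟩ :=
    (Set.two_lt_ncard_iff K.toFinite).1 (by omega)
  obtain ⟨H, hH⟩ := exists_isFlip (G := G) (u := u) (v := v) (w := w)
    ⟨hK u hu v hv huv, hK v hv w hw hvw, hK w hw u hu huw.symm, hfree u hu, hfree v hv, hfree w hw⟩
  refine ⟨H, hH.deg_eq, hsplit.not_reach ?_ fun he => hfree u hu ?_⟩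
  · rintro L ⟨a, b, c, d, hab, hcd, hne, hac, hbd, -⟩
    obtain rfl : a = c := by
      by_contra hac'
      exact hac ⟨hK a hab.2.1 c hcd.2.1 hac', hab.2.1, hcd.2.1⟩
    obtain rfl : b = d := by
      by_contra hbd'
      exact hbd ⟨hK b hab.2.2 d hcd.2.2 hbd', hab.2.2, hcd.2.2⟩
    exact hne rfl
  · have : (H.restrict K).Adj u u := by
      refine ⟨?_, hu, hu⟩
      have := hfree u hu
      rw [← ind_eq_zero] at this
      rw [← ind_eq_one, hH.ind_eq]
      simp [single, this, huv, huw]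
    exact (he ▸ this).1

theorem Q2.exists_not_reach [Fintype V] {G : LoopyGraph V} (h : Q2 G) :
    ∃ H : LoopyGraph V, (∀ z, H.deg z = G.deg z) ∧ ¬ Reach H G := by
  obtain ⟨h3, hdeg, hclique, h2, hthree, hinf⟩ := h
  set C := {u | u ∈ Vset G 0 ∧ (nbr G u ∩ Vset G 0).ncard = 2} with hC
  have hfree : ∀ z ∈ C, ¬ G.Adj z z := fun z hz => hz.1
  have hmem : ∀ z y, ¬ G.Adj z z → ¬ G.Adj y y → G.Adj z y → z ∈ C := by
    intro z y hz hy hzy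
    exact ⟨hz, ((hdeg z hz).resolve_left fun h => h y hy hzy).1⟩
  have hone : ∀ z y, ¬ G.Adj z z → G.Adj y y → G.Adj z y → y ∈ Vset G 1 :=
    fun z y hz hy hzy => mem_Vset_one.2 ⟨hy, z, hz, G.symm _ _ hzy⟩
  have hjoin : ∀ z ∈ C, ∀ a ∈ Vset G 1, G.Adj z a := by
    intro z hz
    refine ((hdeg z hz.1).resolve_left fun h => ?_).2
    have : nbr G z ∩ Vset G 0 = ∅ :=
      Set.eq_empty_of_forall_notMem fun y hy => h y hy.2 hy.1.2
    have h2 := hz.2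
    rw [this, Set.ncard_empty] at h2
    omega
  have hfar : ∀ z, G.Adj z z → z ∉ Vset G 1 → nbr G z = Vset G 1 := by
    intro z hz hz1
    by_cases hz' : z ∈ Vinf G
    · obtain hinf | ⟨h1, hinf⟩ := hinf
      · rw [hinf] at hz'
        exact hz'.elim
      · have := hinf z hz'
        rw [deg, if_pos hz] at this
        rw [h1, ← Set.ncard_eq_zero]
        omega
    · simp only [Vinf, Set.mem_ofPred_eq, not_forall, not_not] at hz'
      obtain ⟨m, hm⟩ := hz'
      refine h2 z ⟨within_subset hthree m hm, fun h => ?_⟩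
      exact (mem_within_one.1 h).elim (fun h => h hz) hz1
  let H : LoopyGraph V :=
    { Adj := fun a b => (G.Adj a b ∧ ¬ (a ∈ C ∧ b ∈ C)) ∨ (a = b ∧ a ∈ C)
      symm := fun a b => by rw [G.adj_comm]; grind }
  have hH : ∀ a b, H.Adj a b ↔ (G.Adj a b ∧ ¬ (a ∈ C ∧ b ∈ C)) ∨ (a = b ∧ a ∈ C) :=
    fun a b => Iff.rfl
  let D := C ∪ {z | G.Adj z z ∧ z ∉ Vset G 1}
  have hdiag : ∀ a ∈ D, ∀ b ∈ D, H.Adj a b ↔ a = b := by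
    have hnot : ∀ a b, G.Adj a a → a ∉ Vset G 1 → b ∈ D → G.Adj a b → a = b := by
      intro a b ha ha1 hb hab
      by_contra hne
      have hb1 : b ∈ Vset G 1 := hfar a ha ha1 ▸ ⟨Ne.symm hne, hab⟩
      obtain hb | hb := hb
      · exact hfree b hb (mem_Vset_one.1 hb1).1
      · exact hb.2 hb1
    rintro a (ha | ha) b hb
    · refine ⟨fun hab => ?_, fun hab => Or.inr ⟨hab, ha⟩⟩
      obtain ⟨hab, hn⟩ | hab := hab
      · obtain hb | hb := hb
        · exact absurd ⟨ha, hb⟩ hn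
        · exact absurd (hone a b (hfree a ha) hb.1 hab) hb.2
      · exact hab.1
    · refine ⟨fun hab => ?_, ?_⟩
      · obtain hab | hab := hab
        · exact hnot a b ha.1 ha.2 hb hab.1
        · exact hab.1
      · rintro rfl
        exact Or.inl ⟨ha.1, fun h => hfree a h.1 ha.1⟩
  have hsplit : H.IsSplit (Vset G 1) D := by
    have hA : ∀ a ∈ Vset G 1, a ∉ C := fun a ha haC => hfree a haC (mem_Vset_one.1 ha).1
    refine ⟨fun a ha b hb => ?_, fun a ha d hd => ?_, fun z y hzA hzD hzy => ?_⟩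
    · refine Or.inl ⟨?_, fun h => hA a ha h.1⟩
      by_cases hab : a = b
      · exact hab ▸ (mem_Vset_one.1 ha).1
      · exact hclique a ha b hb hab
    · refine Or.inl ⟨?_, fun h => hA a ha h.1⟩
      obtain hd | hd := hd
      · exact G.symm _ _ (hjoin d hd a ha)
      · exact G.symm _ _ ((hfar d hd.1 hd.2).symm ▸ ha : a ∈ nbr G d).2
    · have hzC : z ∉ C := fun h => hzD (Or.inl h)
      have hz : ¬ G.Adj z z := fun h => hzD (Or.inr ⟨h, hzA⟩)
      have hzy : G.Adj z y := by
        have := (hH z y).1 hzy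
        tauto
      by_cases hy : G.Adj y y
      · exact hone z y hz hy hzy
      · exact absurd (hmem z y hz hy hzy) hzC
  refine ⟨H, fun z => ?_, hsplit.not_reach ?_ fun he => ?_⟩
  · by_cases hz : z ∈ C
    · have h1 : nbr H z = nbr G z \ Vset G 0 := by
        ext y
        have := hmem y z
        have := hfree y
        have := G.adj_comm (a := z) (b := y)
        have hzf := hfree z hz
        simp only [nbr, hH, Set.mem_ofPred_eq, Set.mem_sdiff, Vset]
        grind
      rw [deg, deg, if_neg (hfree z hz), if_pos (Or.inr ⟨rfl, hz⟩), h1, ← hz.2]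
      have := Set.ncard_inter_add_ncard_sdiff_eq_ncard (nbr G z) (Vset G 0)
      omega
    · have h1 : nbr H z = nbr G z := by
        ext y
        simp [nbr, hH, hz]
      simp [deg, h1, hH, hz]
  · rintro L ⟨a, b, c, d, ⟨hab, ha, hb⟩, ⟨hcd, hc, hd⟩, -, -, -, hne, -⟩
    rw [hdiag a ha b hb] at hab
    rw [hdiag c hc d hd] at hcd
    exact hne (by rw [hab, hcd])
  · obtain ⟨z, hz⟩ : C.Nonempty := Set.nonempty_of_ncard_ne_zero (by omega)
    have hzz : (H.restrict D).Adj z z := ⟨Or.inr ⟨rfl, hz⟩, Or.inl hz, Or.inl hz⟩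
    exact hfree z hz (he ▸ hzz).1

end LoopyGraph

/-- For any degree sequence realizable by a loopy graph, `𝒢(k)` is
disconnected iff some loopy graph with degree sequence `k` is in class `Q1` or `Q2`. -/
theorem disconnected_iff_exists_Q1_or_Q2 {V : Type} [Fintype V] (k : V → ℕ)
    (hreal : ∃ G : LoopyGraph V, ∀ v, G.deg v = k v) :
    ¬ LoopyGraph.GConnected k ↔
      ∃ G : LoopyGraph V, (∀ v, G.deg v = k v) ∧ (G.Q1 ∨ G.Q2) := by
  constructor
  · intro hconn
    by_contra hQ
    refine hconn (LoopyGraph.gConnected_of_flip fun G H u v w hG hGH => ?_)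
    by_contra hreach
    exact hQ ⟨G, hG, LoopyGraph.IsBad.q1_or_q2 ⟨H, hGH, hreach⟩⟩
  · rintro ⟨G, hG, hQ | hQ⟩ hconn
    · obtain ⟨H, hH, hreach⟩ := hQ.exists_not_reach
      exact hreach (hconn G H hG fun z => (hH z).trans (hG z))
    · obtain ⟨H, hH, hreach⟩ := hQ.exists_not_reach
      exact hreach (hconn H G (fun z => (hH z).trans (hG z)) hG)
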